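/- Assume n ≥ 1, (A, B) is controllable, and (C, A) is observable. If there exists a stabilizing controller of order n−1, i.e. 𝒞_{n−1} ≠ ∅, then the set 𝒞_n of full-order stabilizing controllers is path-connected. -/

import Mathlib

open Matrix

noncomputable section

/-- A real square matrix is stable (Hurwitz): every eigenvalue of the matrix,
regarded as a complex matrix, has negative real part. -/
def IsStableMatrix {k : Type*} [Fintype k] [DecidableEq k] (M : Matrix k k ℝ) : Prop :=
  ∀ μ ∈ spectrum ℂ (M.map (algebraMap ℝ ℂ)), μ.re < 0

/-- `(A, B)` is controllable: the controllability matrix `[B, A·B, …, A^{r−1}·B]` has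
rank `r`. -/
def Controllable {r s : ℕ} (A : Matrix (Fin r) (Fin r) ℝ) (B : Matrix (Fin r) (Fin s) ℝ) :
    Prop :=
  (Matrix.of fun (i : Fin r) (kj : Fin r × Fin s) => (A ^ (kj.1 : ℕ) * B) i kj.2).rank = r

/-- The set `𝒞_q` of stabilizing controllers of order `q` for the plant `(A, B, C)`. -/
def Cset {n m p : ℕ} (A : Matrix (Fin n) (Fin n) ℝ) (B : Matrix (Fin n) (Fin m) ℝ)
    (C : Matrix (Fin p) (Fin n) ℝ) (q : ℕ) :
    Set (Matrix (Fin q) (Fin q) ℝ × Matrix (Fin q) (Fin p) ℝ × Matrix (Fin m) (Fin q) ℝ) :=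
  {K | IsStableMatrix (fromBlocks A (B * K.2.2) (K.2.1 * C) K.1)}

open Filter Topology

set_option linter.unusedSectionVars false

section Aux

variable {k : Type*} [Fintype k] [DecidableEq k]

/-- Positivity of the quadratic form (no symmetry required). -/
def QPos (S : Matrix k k ℝ) : Prop := ∀ x : k → ℝ, x ≠ 0 → 0 < x ⬝ᵥ S *ᵥ x

lemma qpos_iff_sphere (S : Matrix k k ℝ) :
    QPos S ↔ ∀ x ∈ Metric.sphere (0 : k → ℝ) 1, 0 < x ⬝ᵥ S *ᵥ x := by
  constructor
  · intro h x hx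
    apply h
    rintro rfl
    simp at hx
  · intro h x hx
    have hx' : 0 < ‖x‖ := norm_pos_iff.2 hx
    have := h (‖x‖⁻¹ • x) (by
      simp [norm_smul, hx'.ne'])
    rw [mulVec_smul, smul_dotProduct, dotProduct_smul, smul_eq_mul, smul_eq_mul] at this
    have h2 : 0 < ‖x‖⁻¹ := inv_pos.2 hx'
    exact pos_of_mul_pos_right (pos_of_mul_pos_right this h2.le) h2.le

lemma isOpen_qpos : IsOpen {S : Matrix k k ℝ | QPos S} := by
  rw [isOpen_iff_eventually]
  intro S hS
  simp only [Set.mem_ofPred_eq, qpos_iff_sphere] at hS ⊢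
  apply (isCompact_sphere (0 : k → ℝ) 1).eventually_forall_of_forall_eventually
  intro x hx
  have hc : Continuous fun z : Matrix k k ℝ × (k → ℝ) => z.2 ⬝ᵥ z.1 *ᵥ z.2 := by
    fun_prop
  exact hc.continuousAt.eventually (lt_mem_nhds (hS x hx))

lemma qpos_one : QPos (1 : Matrix k k ℝ) := by
  intro x hx
  rw [one_mulVec]
  have h0 : 0 ≤ x ⬝ᵥ x := Finset.sum_nonneg fun i _ => mul_self_nonneg _
  exact lt_of_le_of_ne h0 fun h => hx (dotProduct_self_eq_zero.1 h.symm)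

/-- Stability in terms of real eigen-pairs. -/
lemma isStable_iff (M : Matrix k k ℝ) : IsStableMatrix M ↔
    ∀ (α β : ℝ) (a b : k → ℝ), (a ≠ 0 ∨ b ≠ 0) → M *ᵥ a = α • a - β • b →
      M *ᵥ b = β • a + α • b → α < 0 := by
  have key : ∀ μ : ℂ, μ ∈ spectrum ℂ (M.map (algebraMap ℝ ℂ)) ↔
      ∃ v : k → ℂ, v ≠ 0 ∧ (M.map (algebraMap ℝ ℂ)) *ᵥ v = μ • v := by
    intro μ
    rw [spectrum.mem_iff, Matrix.isUnit_iff_isUnit_det, isUnit_iff_ne_zero, not_not,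
      ← Matrix.exists_mulVec_eq_zero_iff]
    refine exists_congr fun v => and_congr_right fun _ => ?_
    rw [sub_mulVec, sub_eq_zero, Algebra.algebraMap_eq_smul_one, smul_mulVec, one_mulVec, eq_comm]
  have hre : ∀ v : k → ℂ, ∀ i, (((M.map (algebraMap ℝ ℂ)) *ᵥ v) i).re
      = (M *ᵥ (fun i => (v i).re)) i := by
    intro v i
    simp [mulVec, dotProduct]
  have him : ∀ v : k → ℂ, ∀ i, (((M.map (algebraMap ℝ ℂ)) *ᵥ v) i).im
      = (M *ᵥ (fun i => (v i).im)) i := by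
    intro v i
    simp [mulVec, dotProduct]
  constructor
  · intro h α β a b hab ha hb
    have := h ⟨α, β⟩ ((key _).2 ⟨fun i => ⟨a i, b i⟩, ?_, ?_⟩)
    · exact this
    · intro h0
      rcases hab with h1 | h1
      · exact h1 (funext fun i => congrArg Complex.re (congrFun h0 i))
      · exact h1 (funext fun i => congrArg Complex.im (congrFun h0 i))
    · funext i
      apply Complex.ext
      · rw [hre]
        simp [ha]
      · rw [him]
        simp [hb]
        ring
  · intro h μ hμ
    obtain ⟨v, hv, hMv⟩ := (key μ).1 hμ
    refine h μ.re μ.im (fun i => (v i).re) (fun i => (v i).im) ?_ ?_ ?_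
    · by_contra hc
      push Not at hc
      exact hv (funext fun i => Complex.ext (congrFun hc.1 i) (congrFun hc.2 i))
    · funext i
      rw [← hre, hMv]
      simp
    · funext i
      rw [← him, hMv]
      simp
      ring

lemma det_ne_zero_of_qpos {S : Matrix k k ℝ} (h : QPos S) : S.det ≠ 0 := by
  intro h0
  obtain ⟨v, hv, h1⟩ := Matrix.exists_mulVec_eq_zero_iff.2 h0
  have := h v hv
  rw [h1] at this
  simp at this

lemma stable_of_lyap (M U V : Matrix k k ℝ) (hs : (V * U)ᵀ = V * U) (hQ : QPos (V * U))
    (hW : QPos (-(V * M * U))) : IsStableMatrix M := by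
  rw [isStable_iff]
  intro α β a b hab ha hb
  have hdet : IsUnit U.det := by
    have := det_ne_zero_of_qpos hQ
    rw [det_mul] at this
    exact (right_ne_zero_of_mul this).isUnit
  obtain ⟨a, rfl⟩ : ∃ a', a = U *ᵥ a' := ⟨U⁻¹ *ᵥ a, by simp [mulVec_mulVec, mul_nonsing_inv _ hdet]⟩
  obtain ⟨b, rfl⟩ : ∃ b', b = U *ᵥ b' := ⟨U⁻¹ *ᵥ b, by simp [mulVec_mulVec, mul_nonsing_inv _ hdet]⟩
  have ha' : (V * M * U) *ᵥ a = α • ((V * U) *ᵥ a) - β • ((V * U) *ᵥ b) := by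
    rw [← mulVec_mulVec, ← mulVec_mulVec, ha]
    simp [mulVec_sub, mulVec_smul, mulVec_mulVec]
  have hb' : (V * M * U) *ᵥ b = β • ((V * U) *ᵥ a) + α • ((V * U) *ᵥ b) := by
    rw [← mulVec_mulVec, ← mulVec_mulVec, hb]
    simp [mulVec_add, mulVec_smul, mulVec_mulVec]
  have hsym : b ⬝ᵥ (V * U) *ᵥ a = a ⬝ᵥ (V * U) *ᵥ b := by
    rw [dotProduct_mulVec, ← mulVec_transpose, hs, dotProduct_comm]
  have e1 : a ⬝ᵥ (V * M * U) *ᵥ a + b ⬝ᵥ (V * M * U) *ᵥ b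
      = α * (a ⬝ᵥ (V * U) *ᵥ a + b ⬝ᵥ (V * U) *ᵥ b) := by
    rw [ha', hb']
    simp only [dotProduct_sub, dotProduct_add, dotProduct_smul, smul_eq_mul, hsym]
    ring
  have nn : ∀ (S : Matrix k k ℝ), QPos S → ∀ x, 0 ≤ x ⬝ᵥ S *ᵥ x := by
    intro S hS x
    by_cases h : x = 0
    · simp [h]
    · exact (hS x h).le
  have n1 := nn _ hQ a
  have n2 := nn _ hQ b
  have n3 := nn _ hW a
  have n4 := nn _ hW b
  simp only [neg_mulVec, dotProduct_neg] at n3 n4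
  have : a ≠ 0 ∨ b ≠ 0 := by
    rcases hab with h | h
    · left; rintro rfl; simp at h
    · right; rintro rfl; simp at h
  rcases this with h | h
  · have p1 := hQ a h
    have p2 := hW a h
    simp only [neg_mulVec, dotProduct_neg] at p2
    nlinarith
  · have p1 := hQ b h
    have p2 := hW b h
    simp only [neg_mulVec, dotProduct_neg] at p2
    nlinarith

section
attribute [local instance] Matrix.linftyOpNormedRing Matrix.linftyOpNormedAlgebra

lemma tendsto_pow_zero_of_spectrum (N : Matrix k k ℂ) (h : ∀ z ∈ spectrum ℂ N, ‖z‖ < 1) :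
    Tendsto (fun j : ℕ => N ^ j) atTop (𝓝 0) := by
  rcases subsingleton_or_nontrivial (Matrix k k ℂ) with hs | hs
  · have : (fun j : ℕ => N ^ j) = fun _ => 0 := funext fun j => Subsingleton.elim _ _
    rw [this]
    exact tendsto_const_nhds
  have hc : CompleteSpace (Matrix k k ℂ) := FiniteDimensional.complete ℂ _
  have hr : spectralRadius ℂ N < (1 : NNReal) :=
    spectrum.spectralRadius_lt_of_forall_lt N (fun z hz => h z hz)
  obtain ⟨r, hr1, hr2⟩ := ENNReal.lt_iff_exists_nnreal_btwn.1 hr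
  have hr2' : r < 1 := by exact_mod_cast hr2
  have ht := spectrum.pow_nnnorm_pow_one_div_tendsto_nhds_spectralRadius N
  have hev : ∀ᶠ j : ℕ in atTop, ‖N ^ j‖ ≤ (r : ℝ) ^ j := by
    filter_upwards [ht.eventually (gt_mem_nhds hr1), eventually_gt_atTop 0] with j hj hj0
    have h1 : (‖N ^ j‖₊ : ENNReal) < (r : ENNReal) ^ (j : ℝ) := by
      have h2 := ENNReal.rpow_lt_rpow hj (Nat.cast_pos.2 hj0 : (0 : ℝ) < j)
      rwa [← ENNReal.rpow_mul, one_div, inv_mul_cancel₀ (by positivity), ENNReal.rpow_one] at h2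
    rw [ENNReal.rpow_natCast] at h1
    have h3 : ‖N ^ j‖₊ < r ^ j := by exact_mod_cast h1
    exact_mod_cast h3.le
  refine tendsto_zero_iff_norm_tendsto_zero.2 ?_
  refine squeeze_zero' (Eventually.of_forall fun _ => norm_nonneg _) hev ?_
  exact tendsto_pow_atTop_nhds_zero_of_lt_one r.2 (by exact_mod_cast hr2')
end

lemma lyap_of_stable (M : Matrix k k ℝ) (hM : IsStableMatrix M) :
    ∃ P : Matrix k k ℝ, Pᵀ = P ∧ QPos P ∧ QPos (-(M * P)) := by
  have hdet : IsUnit (1 - M).det := by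
    rw [isUnit_iff_ne_zero]
    intro h0
    obtain ⟨v, hv, h1⟩ := Matrix.exists_mulVec_eq_zero_iff.2 h0
    rw [sub_mulVec, one_mulVec, sub_eq_zero] at h1
    have := (isStable_iff M).1 hM 1 0 v 0 (Or.inl hv) (by simp [← h1]) (by simp)
    linarith
  set R := (1 - M)⁻¹ with hR
  have hR1 : (1 - M) * R = 1 := mul_nonsing_inv _ hdet
  have hR2 : R * (1 - M) = 1 := nonsing_inv_mul _ hdet
  set N := (1 + M) * R with hN
  have hNM : N * (1 - M) = 1 + M := by rw [hN, Matrix.mul_assoc, hR2, Matrix.mul_one]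
  set φ : Matrix k k ℝ →+* Matrix k k ℂ := (algebraMap ℝ ℂ).mapMatrix with hφ
  have hspec : ∀ z ∈ spectrum ℂ (φ N), ‖z‖ < 1 := by
    intro z hz
    rw [spectrum.mem_iff, Matrix.isUnit_iff_isUnit_det, isUnit_iff_ne_zero, not_not,
      ← Matrix.exists_mulVec_eq_zero_iff] at hz
    obtain ⟨v, hv, hzv⟩ := hz
    rw [sub_mulVec, sub_eq_zero, Algebra.algebraMap_eq_smul_one, smul_mulVec, one_mulVec] at hzv
    obtain ⟨w, hv2⟩ : ∃ w, v = φ (1 - M) *ᵥ w :=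
      ⟨φ R *ᵥ v, by rw [mulVec_mulVec, ← map_mul, hR1, map_one, one_mulVec]⟩
    have hw0 : w ≠ 0 := by
      rintro h
      rw [h] at hv2
      simp at hv2
      exact hv hv2
    rw [hv2, mulVec_mulVec, ← map_mul, hNM, map_sub, map_add, map_one, add_mulVec, sub_mulVec,
      one_mulVec] at hzv
    have h3 : (1 + z) • (φ M *ᵥ w) = (z - 1) • w := by
      have : z • w - z • (φ M *ᵥ w) = w + φ M *ᵥ w := by rw [← smul_sub]; exact hzv
      rw [add_smul, one_smul, sub_smul, one_smul]
      rw [sub_eq_iff_eq_add] at this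
      rw [this]
      abel
    have hz1 : 1 + z ≠ 0 := by
      intro h
      have hz : z = -1 := by linear_combination h
      rw [h, zero_smul, eq_comm, smul_eq_zero, hz] at h3
      rcases h3 with h3 | h3
      · norm_num at h3
      · exact hw0 h3
    have h4 : φ M *ᵥ w = ((z - 1) / (1 + z)) • w := by
      rw [div_eq_inv_mul, mul_smul, ← h3, smul_smul, inv_mul_cancel₀ hz1, one_smul]
    have h5 : ((z - 1) / (1 + z)).re < 0 := by
      apply hM
      rw [spectrum.mem_iff, Matrix.isUnit_iff_isUnit_det, isUnit_iff_ne_zero, not_not,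
        ← Matrix.exists_mulVec_eq_zero_iff]
      refine ⟨w, hw0, ?_⟩
      rw [sub_mulVec, sub_eq_zero, Algebra.algebraMap_eq_smul_one, smul_mulVec, one_mulVec]
      exact h4.symm
    have h6 : 0 < Complex.normSq (1 + z) := Complex.normSq_pos.2 hz1
    rw [Complex.div_re, ← add_div, div_neg_iff] at h5
    have h7 : Complex.normSq z < 1 := by
      rcases h5 with h5 | h5
      · linarith [h5.2]
      · have := h5.1
        simp at this
        rw [Complex.normSq_apply]
        nlinarith
    rw [Complex.normSq_eq_norm_sq] at h7
    nlinarith [norm_nonneg z]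
  have ht := tendsto_pow_zero_of_spectrum _ hspec
  have ht' : Tendsto (fun j : ℕ => N ^ j) atTop (𝓝 0) := by
    have hc : Continuous fun S : Matrix k k ℂ => S.map Complex.re :=
      Continuous.matrix_map continuous_id Complex.continuous_re
    have := (hc.tendsto 0).comp ht
    refine (this.congr fun j => ?_).trans (le_of_eq ?_)
    · simp only [Function.comp, ← map_pow]
      ext a b
      simp [hφ]
    · congr 1
  have ht2 : Tendsto (fun j : ℕ => 1 - N ^ j * (N ^ j)ᵀ) atTop (𝓝 1) := by
    have hc : Continuous fun S : Matrix k k ℝ => 1 - S * Sᵀ := by fun_prop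
    have := (hc.tendsto 0).comp ht'
    simpa [Function.comp_def] using this
  obtain ⟨J, hJ, hJ0⟩ := ((ht2.eventually (isOpen_qpos.mem_nhds qpos_one)).and
    (eventually_gt_atTop 0)).exists
  replace hJ : QPos (1 - N ^ J * (N ^ J)ᵀ) := hJ
  set P0 : Matrix k k ℝ := ∑ j ∈ Finset.range J, N ^ j * (N ^ j)ᵀ with hP0
  have hP0s : P0ᵀ = P0 := by
    simp [hP0, transpose_sum, transpose_mul]
  have hP0e : P0 - N * P0 * Nᵀ = 1 - N ^ J * (N ^ J)ᵀ := by
    have : N * P0 * Nᵀ = ∑ j ∈ Finset.range J, N ^ (j + 1) * (N ^ (j + 1))ᵀ := by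
      rw [hP0, Matrix.mul_sum, Matrix.sum_mul]
      refine Finset.sum_congr rfl fun j _ => ?_
      rw [pow_succ', transpose_mul N (N ^ j)]
      simp only [Matrix.mul_assoc]
    rw [this, hP0, ← Finset.sum_sub_distrib, Finset.sum_range_sub']
    simp
  have hP0q : QPos P0 := by
    intro x hx
    rw [hP0, sum_mulVec, dotProduct_sum]
    refine Finset.sum_pos' (fun j _ => ?_) ⟨0, Finset.mem_range.2 hJ0, ?_⟩
    · rw [← mulVec_mulVec, dotProduct_mulVec, ← mulVec_transpose]
      exact Finset.sum_nonneg fun i _ => mul_self_nonneg _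
    · simpa using qpos_one x hx
  have hcong : P0 = (1 - M) * (R * P0 * Rᵀ) * (1 - M)ᵀ := by
    have e : Rᵀ * (1 - M)ᵀ = 1 := by rw [← transpose_mul, hR1, transpose_one]
    calc P0 = ((1 - M) * R) * P0 * (Rᵀ * (1 - M)ᵀ) := by rw [hR1, e]; simp
      _ = _ := by simp only [Matrix.mul_assoc]
  have hRinj : ∀ x : k → ℝ, x ≠ 0 → Rᵀ *ᵥ x ≠ 0 := by
    intro x hx h
    apply hx
    have : (1 - M)ᵀ *ᵥ (Rᵀ *ᵥ x) = x := by
      rw [mulVec_mulVec, ← transpose_mul, hR2, transpose_one, one_mulVec]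
    rw [← this, h, mulVec_zero]
  set P := R * P0 * Rᵀ with hP
  have hPs : Pᵀ = P := by
    rw [hP, transpose_mul, transpose_mul, hP0s, transpose_transpose, Matrix.mul_assoc]
  refine ⟨P, hPs, ?_, ?_⟩
  · intro x hx
    rw [hP, ← mulVec_mulVec, ← mulVec_mulVec, dotProduct_mulVec, ← mulVec_transpose]
    exact hP0q _ (hRinj x hx)
  · have e1 : N * P0 * Nᵀ = (1 + M) * P * (1 + M)ᵀ := by
      rw [hN, hP, transpose_mul]
      simp only [Matrix.mul_assoc]
    rw [e1, hcong] at hP0e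
    have e2 : (1 - M) * P * (1 - M)ᵀ - (1 + M) * P * (1 + M)ᵀ = -(2 : ℝ) • (M * P + P * Mᵀ) := by
      simp only [transpose_sub, transpose_add, transpose_one, Matrix.add_mul, Matrix.sub_mul,
        Matrix.mul_add, Matrix.mul_sub, Matrix.one_mul, Matrix.mul_one]
      module
    rw [e2] at hP0e
    intro x hx
    have h1 := hJ x hx
    rw [← hP0e] at h1
    have e3 : x ⬝ᵥ (P * Mᵀ) *ᵥ x = x ⬝ᵥ (M * P) *ᵥ x := by
      rw [dotProduct_mulVec, ← mulVec_transpose, transpose_mul, transpose_transpose, hPs,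
        dotProduct_comm]
    rw [smul_mulVec, add_mulVec, dotProduct_smul, dotProduct_add, e3, smul_eq_mul] at h1
    rw [neg_mulVec, dotProduct_neg]
    linarith

end Aux

section GLPath

variable {ι : Type*} [Fintype ι] [DecidableEq ι]

/-- The set of invertible real matrices. -/
def GLset (ι : Type*) [Fintype ι] [DecidableEq ι] : Set (Matrix ι ι ℝ) := {T | T.det ≠ 0}

/-- The coordinate reflection. -/
def reflMat (i : ι) : Matrix ι ι ℝ := diagonal (Function.update 1 i (-1))

lemma reflMat_mul_self (i : ι) : reflMat i * reflMat i = 1 := by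
  rw [reflMat, diagonal_mul_diagonal, ← diagonal_one]
  congr 1
  funext j
  by_cases h : j = i
  · subst h; simp
  · simp [h]

lemma reflMat_mem (i : ι) : reflMat i ∈ GLset ι := by
  intro h
  have := congrArg det (reflMat_mul_self i)
  rw [det_mul, h] at this
  simp at this

lemma GLset_joined_mul {a b c d : Matrix ι ι ℝ} (h1 : JoinedIn (GLset ι) a b)
    (h2 : JoinedIn (GLset ι) c d) : JoinedIn (GLset ι) (a * c) (b * d) := by
  refine (h1.mul h2).mono ?_
  rintro _ ⟨x, hx, y, hy, rfl⟩
  change (x * y).det ≠ 0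
  rw [det_mul]
  exact mul_ne_zero hx hy

/-- Householder reflection. -/
def hh (v : ι → ℝ) : Matrix ι ι ℝ :=
  1 + replicateCol Unit (-(2 / (v ⬝ᵥ v)) • v) * replicateRow Unit v

lemma hh_mem {v : ι → ℝ} (hv : v ≠ 0) : hh v ∈ GLset ι := by
  have h : v ⬝ᵥ v ≠ 0 := fun h => hv (dotProduct_self_eq_zero.1 h)
  change (hh v).det ≠ 0
  rw [hh, det_one_add_replicateCol_mul_replicateRow, dotProduct_smul, smul_eq_mul]
  field_simp
  norm_num

lemma hh_single (i : ι) : hh (Pi.single i 1) = reflMat i := by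
  ext a b
  simp only [hh, reflMat, Matrix.add_apply, Matrix.mul_apply, diagonal_apply, one_apply]
  by_cases ha : a = i <;> by_cases hb : b = i <;> by_cases hab : a = b <;>
    simp_all
  norm_num

lemma refl_joined (i j : ι) : JoinedIn (GLset ι) (reflMat i) (reflMat j) := by
  by_cases hij : i = j
  · subst hij
    exact JoinedIn.refl (reflMat_mem i)
  have hne : ∀ t : ℝ, (1 - t) • (Pi.single i 1 : ι → ℝ) + t • Pi.single j 1 ≠ 0 := by
    intro t h
    have h1 := congrFun h i
    have h2 := congrFun h j
    simp [hij, Ne.symm hij] at h1 h2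
    linarith
  refine JoinedIn.ofLine
    (f := fun t : ℝ => hh ((1 - t) • (Pi.single i 1 : ι → ℝ) + t • Pi.single j 1)) ?_ ?_ ?_ ?_
  · apply Continuous.continuousOn
    have hc : Continuous fun t : ℝ => (1 - t) • (Pi.single i 1 : ι → ℝ) + t • Pi.single j 1 := by
      fun_prop
    unfold hh
    have h2 : Continuous fun t : ℝ => (2 / (((1 - t) • (Pi.single i 1 : ι → ℝ) + t • Pi.single j 1)
      ⬝ᵥ ((1 - t) • (Pi.single i 1 : ι → ℝ) + t • Pi.single j 1))) := by
      refine continuous_const.div (hc.dotProduct hc) fun t h => hne t (dotProduct_self_eq_zero.1 h)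
    refine continuous_const.add (Continuous.matrix_mul ?_ ?_)
    · exact (h2.neg.smul hc).matrix_replicateCol
    · exact hc.matrix_replicateRow
  · simp [hh_single]
  · simp [hh_single]
  · rintro _ ⟨t, _, rfl⟩
    exact hh_mem (hne t)

lemma diag_mem {D : ι → ℝ} : diagonal D ∈ GLset ι ↔ ∀ i, D i ≠ 0 := by
  change (diagonal D).det ≠ 0 ↔ _
  rw [det_diagonal, Finset.prod_ne_zero_iff]
  simp

lemma single_diag_joined (i : ι) (d : ℝ) (hd : d ≠ 0) :
    JoinedIn (GLset ι) (diagonal (Function.update 1 i d))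
      (diagonal (Function.update 1 i (if 0 < d then 1 else -1))) := by
  set s : ℝ := if 0 < d then 1 else -1 with hs
  refine JoinedIn.ofLine
    (f := fun t : ℝ => diagonal (Function.update (1 : ι → ℝ) i ((1 - t) * d + t * s))) ?_ ?_ ?_ ?_
  · apply Continuous.continuousOn
    apply Continuous.matrix_diagonal
    exact continuous_const.update i (by fun_prop)
  · simp
  · simp
  · rintro _ ⟨t, ⟨ht0, ht1⟩, rfl⟩
    rw [diag_mem]
    intro j
    by_cases h : j = i
    · subst h
      simp only [Function.update_self]
      by_cases h0 : 0 < d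
      · rw [hs, if_pos h0]
        rcases ht1.lt_or_eq with h1 | h1
        · have := mul_pos (sub_pos.2 h1) h0
          intro h; linarith
        · subst h1; norm_num
      · rw [hs, if_neg h0]
        have h0' : d < 0 := lt_of_le_of_ne (not_lt.1 h0) hd
        rcases ht1.lt_or_eq with h1 | h1
        · have := mul_neg_of_pos_of_neg (sub_pos.2 h1) h0'
          intro h; linarith
        · subst h1; norm_num
    · simp [h]

/-- `T` is connected to the identity or to a fixed reflection within `GL`. -/
def GLP (i0 : ι) (T : Matrix ι ι ℝ) : Prop :=
  JoinedIn (GLset ι) T 1 ∨ JoinedIn (GLset ι) T (reflMat i0)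

lemma GLP_mul (i0 : ι) {S T : Matrix ι ι ℝ} (hS : GLP i0 S) (hT : GLP i0 T) : GLP i0 (S * T) := by
  rcases hS with hS | hS <;> rcases hT with hT | hT
  · left; simpa using GLset_joined_mul hS hT
  · right; simpa using GLset_joined_mul hS hT
  · right; simpa using GLset_joined_mul hS hT
  · left; simpa [reflMat_mul_self] using GLset_joined_mul hS hT

lemma GLP_one (i0 : ι) : GLP i0 1 := Or.inl (JoinedIn.refl (by simp [GLset]))

lemma GLP_single_diag (i0 i : ι) (d : ℝ) (hd : d ≠ 0) :
    GLP i0 (diagonal (Function.update 1 i d)) := by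
  have h := single_diag_joined i d hd
  by_cases h0 : 0 < d
  · rw [if_pos h0] at h
    left
    have e : Function.update (1 : ι → ℝ) i 1 = 1 := by simp
    rw [e] at h
    exact diagonal_one (α := ℝ) (n := ι) ▸ h
  · rw [if_neg h0] at h
    exact Or.inr (h.trans (refl_joined i i0))

lemma GLP_diag (i0 : ι) (D : ι → ℝ) (hD : ∀ i, D i ≠ 0) : GLP i0 (diagonal D) := by
  have : ∀ s : Finset ι, GLP i0 (diagonal fun j => if j ∈ s then D j else 1) := by
    intro s
    induction s using Finset.induction_on with
    | empty => simpa using GLP_one i0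
    | insert a s ha ih =>
      convert GLP_mul i0 (GLP_single_diag i0 a (D a) (hD a)) ih using 1
      rw [diagonal_mul_diagonal]
      congr 1
      funext j
      by_cases h : j = a
      · subst h; simp [ha]
      · simp [h]
  simpa using this Finset.univ

lemma GLP_all (i0 : ι) (T : Matrix ι ι ℝ) (hT : T.det ≠ 0) : GLP i0 T := by
  refine diagonal_transvection_induction_of_det_ne_zero (GLP i0) T hT ?_ ?_ ?_
  · intro D hD
    exact GLP_diag i0 D (diag_mem.1 hD)
  · intro t
    left
    refine JoinedIn.symm (JoinedIn.ofLine (f := fun c : ℝ => transvection t.i t.j (c * t.c))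
      ?_ ?_ ?_ ?_)
    · apply Continuous.continuousOn
      unfold transvection
      refine continuous_const.add (continuous_matrix fun a b => ?_)
      simp only [single_apply]
      split_ifs <;> fun_prop
    · simp
    · simp [TransvectionStruct.toMatrix]
    · rintro _ ⟨c, _, rfl⟩
      change (transvection t.i t.j (c * t.c)).det ≠ 0
      rw [det_transvection_of_ne _ _ t.hij]
      norm_num
  · intro S T _ _ hS hT
    exact GLP_mul i0 hS hT

end GLPath

section Param

variable {n m p : ℕ}

/-- Parameter space of the linear matrix inequality. -/
abbrev LMIVar (n m p : ℕ) : Type :=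
  Matrix (Fin n) (Fin n) ℝ × Matrix (Fin n) (Fin n) ℝ × Matrix (Fin m) (Fin n) ℝ ×
    Matrix (Fin n) (Fin p) ℝ × Matrix (Fin n) (Fin n) ℝ

/-- The convex set of solutions `(X, Y, F, H, M)` of the linear matrix inequality. -/
def Fset (A : Matrix (Fin n) (Fin n) ℝ) (B : Matrix (Fin n) (Fin m) ℝ)
    (C : Matrix (Fin p) (Fin n) ℝ) : Set (LMIVar n m p) :=
  {Z | Z.1ᵀ = Z.1 ∧ Z.2.1ᵀ = Z.2.1 ∧ QPos (fromBlocks Z.1 1 1 Z.2.1) ∧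
    QPos (-(fromBlocks (A * Z.1 + B * Z.2.2.1) A Z.2.2.2.2 (Z.2.1 * A + Z.2.2.2.1 * C)))}

lemma qpos_combo {k : Type*} [Fintype k] [DecidableEq k] {S T : Matrix k k ℝ} (hS : QPos S)
    (hT : QPos T) {a b : ℝ} (ha : 0 ≤ a) (hb : 0 ≤ b) (hab : a + b = 1) :
    QPos (a • S + b • T) := by
  intro x hx
  have h1 := hS x hx
  have h2 := hT x hx
  simp only [add_mulVec, smul_mulVec, dotProduct_add, dotProduct_smul, smul_eq_mul]
  rcases ha.eq_or_lt with h | h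
  · subst h
    have : b = 1 := by linarith
    subst this
    linarith
  · have := mul_pos h h1
    have := mul_nonneg hb h2.le
    linarith

lemma convex_Fset (A : Matrix (Fin n) (Fin n) ℝ) (B : Matrix (Fin n) (Fin m) ℝ)
    (C : Matrix (Fin p) (Fin n) ℝ) : Convex ℝ (Fset A B C) := by
  rintro ⟨X, Y, F, H, M⟩ ⟨h1, h2, h3, h4⟩ ⟨X', Y', F', H', M'⟩ ⟨h1', h2', h3', h4'⟩ a b ha hb hab
  simp only at h1 h2 h3 h4 h1' h2' h3' h4'
  refine ⟨?_, ?_, ?_, ?_⟩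
  · simp [h1, h1']
  · simp [h2, h2']
  · convert qpos_combo h3 h3' ha hb hab using 1
    simp [fromBlocks_smul, fromBlocks_add, ← add_smul, hab]
  · convert qpos_combo h4 h4' ha hb hab using 1
    simp only [fromBlocks_smul, fromBlocks_add, fromBlocks_neg, Prod.smul_mk, Prod.mk_add_mk]
    congr 1
    · simp only [Matrix.mul_add, Matrix.mul_smul]
      module
    · rw [← add_smul, hab, one_smul]
    · module
    · simp only [Matrix.add_mul, Matrix.smul_mul]
      module

/-- The controller reconstructed from the parameters. -/
def Phi (A : Matrix (Fin n) (Fin n) ℝ) (B : Matrix (Fin n) (Fin m) ℝ)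
    (C : Matrix (Fin p) (Fin n) ℝ) (w : LMIVar n m p × Matrix (Fin n) (Fin n) ℝ) :
    Matrix (Fin n) (Fin n) ℝ × Matrix (Fin n) (Fin p) ℝ × Matrix (Fin m) (Fin n) ℝ :=
  (w.2 * ((1 - w.1.2.1 * w.1.1)⁻¹ * (w.1.2.2.2.2 - w.1.2.1 * A * w.1.1
      - w.1.2.2.2.1 * C * w.1.1 - w.1.2.1 * B * w.1.2.2.1)) * w.2⁻¹,
    w.2 * ((1 - w.1.2.1 * w.1.1)⁻¹ * w.1.2.2.2.1),
    w.1.2.2.1 * w.2⁻¹)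

lemma block_ident (A : Matrix (Fin n) (Fin n) ℝ) (B : Matrix (Fin n) (Fin m) ℝ)
    (C : Matrix (Fin p) (Fin n) ℝ) {AK : Matrix (Fin n) (Fin n) ℝ}
    {BK : Matrix (Fin n) (Fin p) ℝ} {CK : Matrix (Fin m) (Fin n) ℝ}
    {F : Matrix (Fin m) (Fin n) ℝ} {H : Matrix (Fin n) (Fin p) ℝ}
    {X Y M Ξ Θ : Matrix (Fin n) (Fin n) ℝ}
    (hC : CK * Θ = F) (hB : Ξ * BK = H)
    (hA : Ξ * AK * Θ = M - Y * A * X - H * C * X - Y * B * F) :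
    fromBlocks (1 : Matrix (Fin n) (Fin n) ℝ) 0 Y Ξ *
      fromBlocks A (B * CK) (BK * C) (AK : Matrix (Fin n) (Fin n) ℝ) *
      fromBlocks X (1 : Matrix (Fin n) (Fin n) ℝ) Θ 0 =
      fromBlocks (A * X + B * F) A M (Y * A + H * C) := by
  rw [fromBlocks_multiply, fromBlocks_multiply]
  subst hC hB
  congr 1
  · simp [Matrix.mul_assoc]
  · simp
  · have hA' : M = Ξ * AK * Θ + Y * A * X + Ξ * BK * C * X + Y * B * (CK * Θ) := by
      rw [hA]; abel
    rw [hA']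
    simp only [Matrix.add_mul, Matrix.mul_assoc]
    abel
  · simp [Matrix.mul_assoc]

lemma det_one_sub_ne {X Y : Matrix (Fin n) (Fin n) ℝ} (h : QPos (fromBlocks X 1 1 Y)) :
    (1 - Y * X).det ≠ 0 := by
  intro h0
  obtain ⟨v, hv, h1⟩ := Matrix.exists_mulVec_eq_zero_iff.2 h0
  rw [sub_mulVec, one_mulVec, sub_eq_zero] at h1
  have h2 := h (Sum.elim v (-(X *ᵥ v))) (fun hz => hv (funext fun i => congrFun hz (Sum.inl i)))
  rw [fromBlocks_mulVec] at h2
  have e : Sum.elim (X *ᵥ v + 1 *ᵥ (-(X *ᵥ v))) (1 *ᵥ v + Y *ᵥ (-(X *ᵥ v))) =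
      (0 : Fin n ⊕ Fin n → ℝ) := by
    rw [one_mulVec, one_mulVec, mulVec_neg, mulVec_mulVec, ← h1]
    funext i
    rcases i with i | i <;> simp
  simp only [Sum.elim_comp_inl, Sum.elim_comp_inr] at h2
  rw [e] at h2
  simp at h2

lemma Phi_mem (A : Matrix (Fin n) (Fin n) ℝ) (B : Matrix (Fin n) (Fin m) ℝ)
    (C : Matrix (Fin p) (Fin n) ℝ) {w : LMIVar n m p × Matrix (Fin n) (Fin n) ℝ}
    (hZ : w.1 ∈ Fset A B C) (hΘ : w.2 ∈ GLset (Fin n)) : Phi A B C w ∈ Cset A B C n := by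
  obtain ⟨⟨X, Y, F, H, M⟩, Θ⟩ := w
  obtain ⟨hX, hY, hQ, hW⟩ := hZ
  simp only at hX hY hQ hW hΘ
  have hd := (det_one_sub_ne hQ).isUnit
  have hp : IsUnit Θ.det := isUnit_iff_ne_zero.2 hΘ
  have e1 : Θ⁻¹ * Θ = 1 := nonsing_inv_mul _ hp
  have e2 : (1 - Y * X) * (1 - Y * X)⁻¹ = 1 := mul_nonsing_inv _ hd
  have eQ : fromBlocks (1 : Matrix (Fin n) (Fin n) ℝ) 0 Y ((1 - Y * X) * Θ⁻¹) *
      fromBlocks X (1 : Matrix (Fin n) (Fin n) ℝ) Θ 0 = fromBlocks X 1 1 Y := by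
    rw [fromBlocks_multiply]
    congr 1
    · simp
    · simp
    · rw [Matrix.mul_assoc, e1]; simp
    · simp
  have eW := block_ident A B C (AK := (Phi A B C ((X, Y, F, H, M), Θ)).1)
    (BK := (Phi A B C ((X, Y, F, H, M), Θ)).2.1) (CK := (Phi A B C ((X, Y, F, H, M), Θ)).2.2)
    (X := X) (Y := Y) (F := F) (H := H) (M := M) (Ξ := (1 - Y * X) * Θ⁻¹) (Θ := Θ)
    (by simp [Phi, Matrix.mul_assoc, e1])
    (by
      simp only [Phi]
      rw [Matrix.mul_assoc, ← Matrix.mul_assoc Θ⁻¹, e1, Matrix.one_mul, ← Matrix.mul_assoc, e2,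
        Matrix.one_mul])
    (by
      simp only [Phi]
      calc (1 - Y * X) * Θ⁻¹ * (Θ * ((1 - Y * X)⁻¹ * (M - Y * A * X - H * C * X - Y * B * F))
              * Θ⁻¹) * Θ
          = (1 - Y * X) * (Θ⁻¹ * Θ) * ((1 - Y * X)⁻¹ * (M - Y * A * X - H * C * X - Y * B * F))
              * (Θ⁻¹ * Θ) := by simp only [Matrix.mul_assoc]
        _ = ((1 - Y * X) * (1 - Y * X)⁻¹) * (M - Y * A * X - H * C * X - Y * B * F) := by
            rw [e1, Matrix.mul_one, Matrix.mul_one, ← Matrix.mul_assoc (1 - Y * X)]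
        _ = _ := by rw [e2, Matrix.one_mul])
  refine stable_of_lyap _ (fromBlocks X (1 : Matrix (Fin n) (Fin n) ℝ) Θ 0)
    (fromBlocks (1 : Matrix (Fin n) (Fin n) ℝ) 0 Y ((1 - Y * X) * Θ⁻¹)) ?_ ?_ ?_
  · rw [eQ, fromBlocks_transpose, hX, hY, transpose_one]
  · rw [eQ]; exact hQ
  · rw [eW]; exact hW

lemma qpos_congr {k : Type*} [Fintype k] [DecidableEq k] {S V : Matrix k k ℝ} (hS : QPos S)
    (hV : V.det ≠ 0) : QPos (V * S * Vᵀ) := by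
  intro x hx
  rw [← mulVec_mulVec, ← mulVec_mulVec, dotProduct_mulVec, ← mulVec_transpose]
  apply hS
  intro h
  apply hV
  rw [← det_transpose]
  exact Matrix.exists_mulVec_eq_zero_iff.1 ⟨x, hx, h⟩

lemma eventually_det_ne (S : Matrix (Fin n) (Fin n) ℝ) :
    ∀ᶠ ε : ℝ in 𝓝[≠] 0, (S + ε • 1).det ≠ 0 := by
  have hfin : {ε : ℝ | (S + ε • 1).det = 0}.Finite := by
    refine ((-S).charpoly.roots.toFinset.finite_toSet).subset ?_
    intro ε hε
    simp only [Finset.mem_coe, Multiset.mem_toFinset]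
    rw [Polynomial.mem_roots (Matrix.charpoly_monic _).ne_zero, Polynomial.IsRoot,
      Matrix.eval_charpoly]
    have : scalar (Fin n) ε - -S = S + ε • 1 := by
      rw [sub_neg_eq_add, add_comm, smul_one_eq_diagonal]
      rfl
    rw [this]
    exact hε
  have h1 : ({ε : ℝ | (S + ε • 1).det = 0} \ {0})ᶜ ∈ 𝓝 (0 : ℝ) :=
    (hfin.subset Set.sdiff_subset).isClosed.isOpen_compl.mem_nhds (by simp)
  rw [eventually_nhdsWithin_iff]
  filter_upwards [h1] with ε hε hε0 h
  exact hε ⟨h, hε0⟩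

lemma exists_good_lyap {M : Matrix (Fin n ⊕ Fin n) (Fin n ⊕ Fin n) ℝ} (hM : IsStableMatrix M) :
    ∃ X Θ S : Matrix (Fin n) (Fin n) ℝ, Xᵀ = X ∧ Sᵀ = S ∧ Θ.det ≠ 0 ∧
      QPos (fromBlocks X Θᵀ Θ S) ∧ QPos (-(M * fromBlocks X Θᵀ Θ S)) := by
  obtain ⟨P, hs, h1, h2⟩ := lyap_of_stable M hM
  have hP := fromBlocks_toBlocks P
  rw [← hP, fromBlocks_transpose, fromBlocks_inj] at hs
  obtain ⟨s1, s2, s3, s4⟩ := hs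
  set X := P.toBlocks₁₁
  set Θ := P.toBlocks₂₁
  set S := P.toBlocks₂₂
  rw [← s2] at hP
  have hc : Continuous fun ε : ℝ => fromBlocks X (Θ + ε • 1)ᵀ (Θ + ε • 1) S := by
    fun_prop
  have hc2 : Continuous fun ε : ℝ => -(M * fromBlocks X (Θ + ε • 1)ᵀ (Θ + ε • 1) S) := by
    fun_prop
  have e1 : ∀ᶠ ε : ℝ in 𝓝 0, QPos (fromBlocks X (Θ + ε • 1)ᵀ (Θ + ε • 1) S) :=
    hc.continuousAt.eventually (isOpen_qpos.mem_nhds (by simpa [hP] using h1))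
  have e2 : ∀ᶠ ε : ℝ in 𝓝 0, QPos (-(M * fromBlocks X (Θ + ε • 1)ᵀ (Θ + ε • 1) S)) :=
    hc2.continuousAt.eventually (isOpen_qpos.mem_nhds (by simpa [hP] using h2))
  obtain ⟨ε, ⟨f1, f2⟩, f3⟩ := (((e1.and e2).filter_mono nhdsWithin_le_nhds).and
    (eventually_det_ne Θ)).exists
  exact ⟨X, Θ + ε • 1, S, s1, s4, f3, f1, f2⟩

lemma Phi_surj (A : Matrix (Fin n) (Fin n) ℝ) (B : Matrix (Fin n) (Fin m) ℝ)
    (C : Matrix (Fin p) (Fin n) ℝ) {K} (hK : K ∈ Cset A B C n) :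
    ∃ Z ∈ Fset A B C, ∃ Θ ∈ GLset (Fin n), Phi A B C (Z, Θ) = K := by
  obtain ⟨AK, BK, CK⟩ := K
  replace hK : IsStableMatrix (fromBlocks A (B * CK) (BK * C) AK) := hK
  obtain ⟨X, Θ, S, hX, hS, hΘ, h1, h2⟩ := exists_good_lyap hK
  set P := fromBlocks X Θᵀ Θ S with hPdef
  have hPs : Pᵀ = P := by rw [hPdef, fromBlocks_transpose, hX, hS, transpose_transpose]
  have hPd : IsUnit P.det := (det_ne_zero_of_qpos h1).isUnit
  have hG1 : P⁻¹ * P = 1 := nonsing_inv_mul _ hPd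
  have hGs : (P⁻¹)ᵀ = P⁻¹ := by rw [transpose_nonsing_inv, hPs]
  have hGb := fromBlocks_toBlocks P⁻¹
  set Y := (P⁻¹).toBlocks₁₁
  set Ξ := (P⁻¹).toBlocks₁₂
  rw [← hGb, fromBlocks_transpose, fromBlocks_inj] at hGs
  have hY : Yᵀ = Y := hGs.1
  rw [← hGb, hPdef, fromBlocks_multiply, ← fromBlocks_one, fromBlocks_inj] at hG1
  obtain ⟨g1, g2, -, -⟩ := hG1
  have hp : IsUnit Θ.det := isUnit_iff_ne_zero.2 hΘ
  have hU : P * (fromBlocks (1 : Matrix (Fin n) (Fin n) ℝ) 0 Y Ξ)ᵀ =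
      fromBlocks X (1 : Matrix (Fin n) (Fin n) ℝ) Θ 0 := by
    rw [hPdef, fromBlocks_transpose, fromBlocks_multiply]
    congr 1
    · simp
    · rw [← transpose_one, ← g1, transpose_add, transpose_mul, transpose_mul, hX]
    · simp
    · rw [← transpose_zero, ← g2, transpose_add, transpose_mul, transpose_mul, hS,
        transpose_transpose]
  have hUd : (fromBlocks X (1 : Matrix (Fin n) (Fin n) ℝ) Θ 0).det ≠ 0 := by
    have : fromBlocks X (1 : Matrix (Fin n) (Fin n) ℝ) Θ 0 * 
        fromBlocks (0 : Matrix (Fin n) (Fin n) ℝ) Θ⁻¹ (1 : Matrix (Fin n) (Fin n) ℝ) (-(X * Θ⁻¹)) = 1 := by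
      rw [fromBlocks_multiply, ← fromBlocks_one]
      congr 1
      · simp
      · simp
      · simp
      · simp [mul_nonsing_inv _ hp]
    intro h
    have h' := congrArg det this
    rw [det_mul, h] at h'
    simp at h'
  have hVd : (fromBlocks (1 : Matrix (Fin n) (Fin n) ℝ) 0 Y Ξ).det ≠ 0 := by
    rw [← hU, det_mul, det_transpose] at hUd
    exact right_ne_zero_of_mul hUd
  have eQ : fromBlocks (1 : Matrix (Fin n) (Fin n) ℝ) 0 Y Ξ *
      fromBlocks X (1 : Matrix (Fin n) (Fin n) ℝ) Θ 0 = fromBlocks X 1 1 Y := by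
    rw [fromBlocks_multiply]
    congr 1
    · simp
    · simp
    · simp
  have hQ : QPos (fromBlocks X 1 1 Y) := by
    rw [← eQ, ← hU, ← Matrix.mul_assoc]
    exact qpos_congr h1 hVd
  have hd := (det_one_sub_ne hQ).isUnit
  have hΞΘ : 1 - Y * X = Ξ * Θ := by rw [← g1]; abel
  have hx : IsUnit Ξ.det := by
    rw [hΞΘ, det_mul] at hd
    exact isUnit_of_mul_isUnit_left hd
  have hcancel : ∀ {q : ℕ} (D : Matrix (Fin n) (Fin q) ℝ), Θ * ((Ξ * Θ)⁻¹ * (Ξ * D)) = D := by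
    intro q D
    rw [Matrix.mul_inv_rev]
    calc Θ * (Θ⁻¹ * Ξ⁻¹ * (Ξ * D)) = (Θ * Θ⁻¹) * ((Ξ⁻¹ * Ξ) * D) := by
          simp only [Matrix.mul_assoc]
      _ = D := by rw [mul_nonsing_inv _ hp, nonsing_inv_mul _ hx, Matrix.one_mul, Matrix.one_mul]
  set M := Ξ * AK * Θ + Y * A * X + Ξ * BK * C * X + Y * B * (CK * Θ) with hMdef
  have hMsub : M - Y * A * X - Ξ * BK * C * X - Y * B * (CK * Θ) = Ξ * AK * Θ := by
    rw [hMdef]; abel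
  have eW := block_ident A B C (AK := AK) (BK := BK) (CK := CK) (X := X) (Y := Y) (F := CK * Θ)
    (H := Ξ * BK) (M := M) (Ξ := Ξ) (Θ := Θ) rfl rfl hMsub.symm
  refine ⟨(X, Y, CK * Θ, Ξ * BK, M), ⟨hX, hY, hQ, ?_⟩, Θ, hΘ, ?_⟩
  · simp only
    rw [← eW, ← hU]
    convert qpos_congr h2 hVd using 1
    simp only [Matrix.mul_assoc, Matrix.mul_neg, Matrix.neg_mul]
  · simp only [Phi]
    rw [hMsub, hΞΘ, hcancel, Matrix.mul_assoc Ξ, hcancel, Matrix.mul_assoc AK,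
      mul_nonsing_inv _ hp, Matrix.mul_assoc CK, mul_nonsing_inv _ hp, Matrix.mul_one,
      Matrix.mul_one]

lemma continuousOn_inv_comp {α : Type*} [TopologicalSpace α] {s : Set α}
    {f : α → Matrix (Fin n) (Fin n) ℝ} (hf : Continuous f) (h : ∀ x ∈ s, (f x).det ≠ 0) :
    ContinuousOn (fun x => (f x)⁻¹) s := by
  intro x hx
  have h1 : ContinuousAt (fun T : Matrix (Fin n) (Fin n) ℝ => T⁻¹) (f x) := by
    apply continuousAt_matrix_inv
    rw [Ring.inverse_eq_inv']
    exact continuousAt_inv₀ (h x hx)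
  exact (ContinuousAt.comp (f := f) h1 hf.continuousAt).continuousWithinAt

lemma continuousOn_matrix_mul' {α : Type*} [TopologicalSpace α] {s : Set α} {a b c : ℕ}
    {f : α → Matrix (Fin a) (Fin b) ℝ} {g : α → Matrix (Fin b) (Fin c) ℝ}
    (hf : ContinuousOn f s) (hg : ContinuousOn g s) : ContinuousOn (fun x => f x * g x) s := by
  rw [continuousOn_iff_continuous_domRestrict] at *
  exact Continuous.matrix_mul hf hg

lemma continuousOn_Phi (A : Matrix (Fin n) (Fin n) ℝ) (B : Matrix (Fin n) (Fin m) ℝ)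
    (C : Matrix (Fin p) (Fin n) ℝ) :
    ContinuousOn (Phi A B C) (Fset A B C ×ˢ GLset (Fin n)) := by
  have i1 : ContinuousOn (fun w : LMIVar n m p × Matrix (Fin n) (Fin n) ℝ =>
      (1 - w.1.2.1 * w.1.1)⁻¹) (Fset A B C ×ˢ GLset (Fin n)) :=
    continuousOn_inv_comp (by fun_prop) fun w hw => det_one_sub_ne hw.1.2.2.1
  have i2 : ContinuousOn (fun w : LMIVar n m p × Matrix (Fin n) (Fin n) ℝ => w.2⁻¹)
      (Fset A B C ×ˢ GLset (Fin n)) :=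
    continuousOn_inv_comp (by fun_prop) fun w hw => hw.2
  refine ContinuousOn.prodMk ?_ (ContinuousOn.prodMk ?_ ?_)
  · refine continuousOn_matrix_mul' (continuousOn_matrix_mul' (Continuous.continuousOn (by fun_prop))
      (continuousOn_matrix_mul' i1 (Continuous.continuousOn (by fun_prop)))) i2
  · exact continuousOn_matrix_mul' (Continuous.continuousOn (by fun_prop))
      (continuousOn_matrix_mul' i1 (Continuous.continuousOn (by fun_prop)))
  · exact continuousOn_matrix_mul' (Continuous.continuousOn (by fun_prop)) i2

lemma Phi_smul (A : Matrix (Fin n) (Fin n) ℝ) (B : Matrix (Fin n) (Fin m) ℝ)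
    (C : Matrix (Fin p) (Fin n) ℝ) (Z : LMIVar n m p) (J Θ : Matrix (Fin n) (Fin n) ℝ)
    (hJ : J * J = 1) : Phi A B C (Z, J * Θ) =
      (J * (Phi A B C (Z, Θ)).1 * J, J * (Phi A B C (Z, Θ)).2.1, (Phi A B C (Z, Θ)).2.2 * J) := by
  have : J⁻¹ = J := inv_eq_left_inv hJ
  simp only [Phi, Matrix.mul_inv_rev, this, Matrix.mul_assoc]

end Param

section Augment

variable {k m p : ℕ} {n : ℕ}

/-- Adding one stable decoupled mode to a controller. -/
def augA (AK : Matrix (Fin k) (Fin k) ℝ) : Matrix (Fin (k + 1)) (Fin (k + 1)) ℝ :=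
  Matrix.of (Fin.snoc (α := fun _ => Fin (k + 1) → ℝ)
    (fun i => Fin.snoc (α := fun _ => ℝ) (AK i) 0) (Fin.snoc (α := fun _ => ℝ) 0 (-1)))

/-- Adding a zero row. -/
def augB (BK : Matrix (Fin k) (Fin p) ℝ) : Matrix (Fin (k + 1)) (Fin p) ℝ :=
  Matrix.of fun i j => Fin.snoc (α := fun _ => ℝ) (fun i => BK i j) 0 i

/-- Adding a zero column. -/
def augC (CK : Matrix (Fin m) (Fin k) ℝ) : Matrix (Fin m) (Fin (k + 1)) ℝ :=
  Matrix.of fun i => Fin.snoc (α := fun _ => ℝ) (CK i) 0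

lemma reflMat_last : reflMat (Fin.last k) =
    diagonal (Fin.snoc (α := fun _ => ℝ) (fun _ : Fin k => 1) (-1)) := by
  rw [reflMat]
  congr 1
  funext i
  refine Fin.lastCases ?_ (fun i => ?_) i
  · simp
  · simp

lemma aug_fixed (AK : Matrix (Fin k) (Fin k) ℝ) (BK : Matrix (Fin k) (Fin p) ℝ)
    (CK : Matrix (Fin m) (Fin k) ℝ) :
    reflMat (Fin.last k) * augA AK * reflMat (Fin.last k) = augA AK ∧
    reflMat (Fin.last k) * augB BK = augB BK ∧ augC CK * reflMat (Fin.last k) = augC CK := by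
  rw [reflMat_last]
  refine ⟨?_, ?_, ?_⟩
  · ext i j
    rw [mul_diagonal, diagonal_mul]
    refine Fin.lastCases ?_ (fun i => ?_) i <;> refine Fin.lastCases ?_ (fun j => ?_) j <;>
      simp [augA]
  · ext i j
    rw [diagonal_mul]
    refine Fin.lastCases ?_ (fun i => ?_) i <;> simp [augB]
  · ext i j
    rw [mul_diagonal]
    refine Fin.lastCases ?_ (fun j => ?_) j <;> simp [augC]

lemma aug_mulVec (A : Matrix (Fin n) (Fin n) ℝ) (B : Matrix (Fin n) (Fin m) ℝ)
    (C : Matrix (Fin p) (Fin n) ℝ) (AK : Matrix (Fin k) (Fin k) ℝ) (BK : Matrix (Fin k) (Fin p) ℝ)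
    (CK : Matrix (Fin m) (Fin k) ℝ) (v : Fin n ⊕ Fin (k + 1) → ℝ) :
    (fromBlocks A (B * augC CK) (augB BK * C) (augA AK) *ᵥ v) (Sum.inr (Fin.last k))
        = - v (Sum.inr (Fin.last k)) ∧
    ∀ i, (fromBlocks A (B * augC CK) (augB BK * C) (augA AK) *ᵥ v) (Sum.map id Fin.castSucc i) =
      (fromBlocks A (B * CK) (BK * C) AK *ᵥ (v ∘ Sum.map id Fin.castSucc)) i := by
  constructor
  · simp [mulVec, dotProduct, Fin.sum_univ_castSucc, augA, augB, Matrix.mul_apply]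
  · rintro (i | i) <;>
    simp [mulVec, dotProduct, Fin.sum_univ_castSucc, augA, augB, augC, Matrix.mul_apply]

lemma aug_mem (A : Matrix (Fin n) (Fin n) ℝ) (B : Matrix (Fin n) (Fin m) ℝ)
    (C : Matrix (Fin p) (Fin n) ℝ) {AK : Matrix (Fin k) (Fin k) ℝ} {BK : Matrix (Fin k) (Fin p) ℝ}
    {CK : Matrix (Fin m) (Fin k) ℝ} (h : (AK, BK, CK) ∈ Cset A B C k) :
    (augA AK, augB BK, augC CK) ∈ Cset A B C (k + 1) := by
  replace h := (isStable_iff _).1 h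
  refine (isStable_iff _).2 ?_
  intro α β a b hab ha hb
  simp only at ha hb h
  have la := congrFun ha (Sum.inr (Fin.last k))
  have lb := congrFun hb (Sum.inr (Fin.last k))
  rw [(aug_mulVec A B C AK BK CK _).1] at la lb
  simp only [Pi.sub_apply, Pi.add_apply, Pi.smul_apply, smul_eq_mul] at la lb
  by_cases h0 : a (Sum.inr (Fin.last k)) = 0 ∧ b (Sum.inr (Fin.last k)) = 0
  · refine h α β (a ∘ Sum.map id Fin.castSucc) (b ∘ Sum.map id Fin.castSucc) ?_ ?_ ?_
    · have key : ∀ v : Fin n ⊕ Fin (k + 1) → ℝ, v (Sum.inr (Fin.last k)) = 0 → v ≠ 0 →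
          v ∘ Sum.map id Fin.castSucc ≠ 0 := by
        intro v hv hv0 hc
        apply hv0
        funext i
        rcases i with i | i
        · exact congrFun hc (Sum.inl i)
        · refine Fin.lastCases hv (fun i => ?_) i
          exact congrFun hc (Sum.inr i)
      exact hab.imp (key a h0.1) (key b h0.2)
    · funext i
      rw [← (aug_mulVec A B C AK BK CK a).2 i, ha]
      rfl
    · funext i
      rw [← (aug_mulVec A B C AK BK CK b).2 i, hb]
      rfl
  · set x := a (Sum.inr (Fin.last k))
    set y := b (Sum.inr (Fin.last k))
    have hpos : 0 < x ^ 2 + y ^ 2 := by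
      by_contra hc
      apply h0
      constructor <;> nlinarith [sq_nonneg x, sq_nonneg y]
    have : (α + 1) * (x ^ 2 + y ^ 2) = 0 := by linear_combination -x * la - y * lb
    rcases mul_eq_zero.1 this with h1 | h1
    · linarith
    · linarith

end Augment

/-- If `(A, B)` is controllable, `(C, A)` is observable and there exists a
stabilizing controller of order `n − 1` (i.e. `𝒞_{n−1} ≠ ∅`), then the set `𝒞_n` of
full-order stabilizing controllers is path-connected. -/
theorem Cn_pathConnected_of_reduced_order (n m p : ℕ)
    (hn : 1 ≤ n) (hm : 0 < m) (hp : 0 < p)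
    (A : Matrix (Fin n) (Fin n) ℝ) (B : Matrix (Fin n) (Fin m) ℝ)
    (C : Matrix (Fin p) (Fin n) ℝ)
    (hctrb : Controllable A B) (hobs : Controllable Aᵀ Cᵀ)
    (hred : (Cset A B C (n - 1)).Nonempty) :
    IsPathConnected (Cset A B C n) := by
  obtain ⟨k, rfl⟩ : ∃ k, n = k + 1 := ⟨n - 1, by omega⟩
  rw [Nat.add_sub_cancel] at hred
  obtain ⟨⟨AK, BK, CK⟩, hK⟩ := hred
  have hK0 := aug_mem A B C hK
  obtain ⟨f1, f2, f3⟩ := aug_fixed AK BK CK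
  set K0 := (augA AK, augB BK, augC CK) with hK0def
  obtain ⟨Z0, hZ0, P0, hP0, hPhi0⟩ := Phi_surj A B C hK0
  have hJ2 := reflMat_mul_self (Fin.last k)
  have hJ : Phi A B C (Z0, reflMat (Fin.last k) * P0) = K0 := by
    rw [Phi_smul _ _ _ _ _ _ hJ2, hPhi0]
    simp only [hK0def]
    rw [f1, f2, f3]
  have himg : Phi A B C '' (Fset A B C ×ˢ GLset (Fin (k + 1))) ⊆ Cset A B C (k + 1) := by
    rintro _ ⟨w, ⟨h1, h2⟩, rfl⟩
    exact Phi_mem A B C h1 h2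
  refine ⟨K0, hK0, ?_⟩
  intro K hK'
  obtain ⟨Z, hZ, P, hP, rfl⟩ := Phi_surj A B C hK'
  have hZZ : JoinedIn (Fset A B C) Z0 Z :=
    ((convex_Fset A B C).isPathConnected ⟨Z0, hZ0⟩).joinedIn Z0 hZ0 Z hZ
  have hp0 : IsUnit P0.det := isUnit_iff_ne_zero.2 hP0
  have hT : (P * P0⁻¹).det ≠ 0 := by
    rw [det_mul]
    exact mul_ne_zero hP (isUnit_nonsing_inv_det _ hp0).ne_zero
  have hPP : P * P0⁻¹ * P0 = P := by rw [Matrix.mul_assoc, nonsing_inv_mul _ hp0, Matrix.mul_one]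
  rcases GLP_all (Fin.last k) _ hT with h | h
  · have h' := GLset_joined_mul h (JoinedIn.refl hP0)
    rw [hPP, Matrix.one_mul] at h'
    have := ((hZZ.prod h'.symm).map_continuousOn (continuousOn_Phi A B C)).mono himg
    rwa [hPhi0] at this
  · have h' := GLset_joined_mul h (JoinedIn.refl hP0)
    rw [hPP] at h'
    have := ((hZZ.prod h'.symm).map_continuousOn (continuousOn_Phi A B C)).mono himg
    rwa [hJ] at this
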